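/- Let A be a De Morgan algebra and let K(A) = {k ∈ A : k ∧ ¬k = 0 and k ∨ ¬k = 1}. Then the following are equivalent: (a) there exists a unary operation ∇ on A satisfying (IS1) ∇0 = 0, (IS2) a ∧ ∇a = a, (IS3) ∇(a ∧ b) = ∇a ∧ ∇b, (IS4) ¬∇a ∧ ∇a = 0; (b) for every a ∈ A the set K_a = {k ∈ K(A) : a ≤ k} has a least element, and the map sending a to the least element of K_a preserves binary meets and binary joins. Moreover, when (a) holds, ∇a is the least element of K_a for every a ∈ A. -/

import Mathlib

section DeMorgan

variable {A : Type*} [DistribLattice A] {neg : A → A}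

theorem deMorgan_neg_sup (neg_neg : ∀ x, neg (neg x) = x)
    (neg_inf : ∀ x y, neg (x ⊓ y) = neg x ⊔ neg y) (x y : A) :
    neg (x ⊔ y) = neg x ⊓ neg y := by
  rw [← neg_neg (neg x ⊓ neg y), neg_inf, neg_neg, neg_neg]

variable [BoundedOrder A]

theorem deMorgan_neg_bot (neg_neg : ∀ x, neg (neg x) = x)
    (neg_inf : ∀ x y, neg (x ⊓ y) = neg x ⊔ neg y) : neg ⊥ = ⊤ := by
  have h := neg_inf ⊥ (neg ⊤)
  rw [bot_inf_eq, neg_neg, sup_top_eq] at h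
  exact h

theorem deMorgan_sup_neg_eq_top (neg_neg : ∀ x, neg (neg x) = x)
    (neg_inf : ∀ x y, neg (x ⊓ y) = neg x ⊔ neg y) {k : A} (hk : k ⊓ neg k = ⊥) :
    k ⊔ neg k = ⊤ := by
  rw [← deMorgan_neg_bot neg_neg neg_inf, ← hk, neg_inf, neg_neg, sup_comm]

theorem deMorgan_sup_inf_neg_eq_bot (neg_neg : ∀ x, neg (neg x) = x)
    (neg_inf : ∀ x y, neg (x ⊓ y) = neg x ⊔ neg y) {k l : A}
    (hk : k ⊓ neg k = ⊥) (hl : l ⊓ neg l = ⊥) : (k ⊔ l) ⊓ neg (k ⊔ l) = ⊥ := by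
  rw [deMorgan_neg_sup neg_neg neg_inf, inf_sup_right, ← inf_assoc, hk, bot_inf_eq,
    inf_left_comm, hl, inf_bot_eq, sup_bot_eq]

theorem deMorgan_isLeast_nabla (neg_neg : ∀ x, neg (neg x) = x)
    (neg_inf : ∀ x y, neg (x ⊓ y) = neg x ⊔ neg y) {nab : A → A}
    (nab_bot : nab ⊥ = ⊥) (inf_nab : ∀ a, a ⊓ nab a = a)
    (nab_inf : ∀ a b, nab (a ⊓ b) = nab a ⊓ nab b)
    (neg_nab_inf : ∀ a, neg (nab a) ⊓ nab a = ⊥) (a : A) :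
    IsLeast {k | (k ⊓ neg k = ⊥ ∧ k ⊔ neg k = ⊤) ∧ a ≤ k} (nab a) := by
  have h : nab a ⊓ neg (nab a) = ⊥ := by rw [inf_comm, neg_nab_inf]
  refine ⟨⟨⟨h, deMorgan_sup_neg_eq_top neg_neg neg_inf h⟩, inf_eq_left.1 (inf_nab a)⟩, ?_⟩
  rintro k ⟨⟨hk, hk'⟩, hak⟩
  have hle : nab a ≤ nab k := by
    rw [← inf_eq_left, ← nab_inf, inf_eq_left.2 hak]
  have hdisj : Disjoint (nab k) (neg k) := by
    refine Disjoint.mono_right (inf_eq_left.1 (inf_nab (neg k))) (disjoint_iff.2 ?_)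
    rw [← nab_inf, hk, nab_bot]
  exact hle.trans (hdisj.le_of_codisjoint (codisjoint_iff.2 (sup_comm k _ ▸ hk')))

end DeMorgan

/-- Characterization of involutive Stone algebras within De Morgan algebras
(Cignoli–Sagastume): on a De Morgan algebra `A`, there is a unary operation `∇`
satisfying (IS1)–(IS4) iff every set `K_a = {k ∈ K(A) : a ≤ k}` has a least
element and the map sending `a` to that least element preserves binary meets
and joins; moreover when (IS1)–(IS4) hold, `∇a` is the least element of `K_a`. -/
theorem deMorgan_exists_nabla_iff_least_of_K
    {A : Type*} [DistribLattice A] [BoundedOrder A] (neg : A → A)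
    (neg_neg : ∀ x, neg (neg x) = x)
    (neg_inf : ∀ x y, neg (x ⊓ y) = neg x ⊔ neg y) :
    ((∃ nab : A → A,
        nab ⊥ = ⊥ ∧
        (∀ a, a ⊓ nab a = a) ∧
        (∀ a b, nab (a ⊓ b) = nab a ⊓ nab b) ∧
        (∀ a, neg (nab a) ⊓ nab a = ⊥)) ↔
      (∃ g : A → A,
        (∀ a, IsLeast {k | (k ⊓ neg k = ⊥ ∧ k ⊔ neg k = ⊤) ∧ a ≤ k} (g a)) ∧
        (∀ a b, g (a ⊓ b) = g a ⊓ g b) ∧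
        (∀ a b, g (a ⊔ b) = g a ⊔ g b)))
    ∧
    (∀ nab : A → A,
      nab ⊥ = ⊥ →
      (∀ a, a ⊓ nab a = a) →
      (∀ a b, nab (a ⊓ b) = nab a ⊓ nab b) →
      (∀ a, neg (nab a) ⊓ nab a = ⊥) →
      ∀ a, IsLeast {k | (k ⊓ neg k = ⊥ ∧ k ⊔ neg k = ⊤) ∧ a ≤ k} (nab a)) := by
  refine ⟨⟨?_, ?_⟩, fun nab h₁ h₂ h₃ h₄ => deMorgan_isLeast_nabla neg_neg neg_inf h₁ h₂ h₃ h₄⟩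
  · rintro ⟨nab, h₁, h₂, h₃, h₄⟩
    have hl := deMorgan_isLeast_nabla neg_neg neg_inf h₁ h₂ h₃ h₄
    have hmono : ∀ {a b}, a ≤ b → nab a ≤ nab b := fun {a b} hab =>
      (hl a).2 ⟨(hl b).1.1, hab.trans (hl b).1.2⟩
    refine ⟨nab, hl, h₃, fun a b =>
      le_antisymm ?_ (sup_le (hmono le_sup_left) (hmono le_sup_right))⟩
    have hk := deMorgan_sup_inf_neg_eq_bot neg_neg neg_inf (hl a).1.1.1 (hl b).1.1.1
    exact (hl (a ⊔ b)).2 ⟨⟨hk, deMorgan_sup_neg_eq_top neg_neg neg_inf hk⟩,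
      sup_le_sup (hl a).1.2 (hl b).1.2⟩
  · rintro ⟨g, hl, hinf, -⟩
    refine ⟨g, ?_, fun a => inf_eq_left.2 (hl a).1.2, hinf, fun a => ?_⟩
    · exact le_bot_iff.1 ((hl ⊥).2
        ⟨⟨bot_inf_eq _, deMorgan_sup_neg_eq_top neg_neg neg_inf (bot_inf_eq _)⟩, le_rfl⟩)
    · rw [inf_comm, (hl a).1.1.1]
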